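/- Let n ≥ 1 and let H ∈ M_{2n,2n}(ℂ) be symplectic (Hᵗ J_{2n} H = J_{2n}) and anti-Hermitian (H = −H̄ᵗ). Then there exists a symplectic matrix V ∈ M_{2n,2n}(ℂ) such that H = i·V S^{2n}_n V̄ᵗ, where i is the imaginary unit. -/

import Mathlib

open Matrix

/-- `J_{2n} = [[0, I_n], [−I_n, 0]]`. -/
noncomputable def Jmat (n : ℕ) : Matrix (Fin (2 * n)) (Fin (2 * n)) ℂ :=
  Matrix.of fun i j =>
    if (i : ℕ) + n = (j : ℕ) then 1 else if (j : ℕ) + n = (i : ℕ) then -1 else 0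

/-- `S^{2n}_n = diag(I_n, −I_n)`. -/
noncomputable def Smat (n p : ℕ) : Matrix (Fin n) (Fin n) ℂ :=
  Matrix.diagonal fun i => if (i : ℕ) < p then 1 else -1

section SymplecticBlocks

variable {l ι : Type*}

/-- The standard symplectic form in block shape, with the identity in the upper right corner. -/
def blockJ (l : Type*) [DecidableEq l] : Matrix (l ⊕ l) (l ⊕ l) ℂ :=
  Matrix.fromBlocks 0 1 (-1) 0

lemma blockJ_mul_self [Fintype l] [DecidableEq l] : blockJ l * blockJ l = -1 := by
  simp [blockJ, Matrix.fromBlocks_multiply, ← Matrix.fromBlocks_one, Matrix.fromBlocks_neg]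

lemma blockJ_transpose [DecidableEq l] : (blockJ l)ᵀ = -blockJ l := by
  simp [blockJ, Matrix.fromBlocks_transpose, Matrix.fromBlocks_neg]

lemma blockJ_conjTranspose [DecidableEq l] : (blockJ l)ᴴ = -blockJ l := by
  simp [blockJ, Matrix.fromBlocks_conjTranspose, Matrix.fromBlocks_neg]

lemma mul_blockJ_mul_transpose [Fintype l] [DecidableEq l]
    {K : Matrix (l ⊕ l) (l ⊕ l) ℂ}
    (hK : Kᵀ * blockJ l * K = -blockJ l) : K * blockJ l * Kᵀ = -blockJ l := by
  have h1 : (blockJ l * Kᵀ * blockJ l) * K = 1 := by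
    rw [Matrix.mul_assoc, Matrix.mul_assoc, ← Matrix.mul_assoc Kᵀ, hK, Matrix.mul_neg,
      blockJ_mul_self, neg_neg]
  have h2 := congrArg (· * blockJ l) (mul_eq_one_comm.mp h1)
  simp only [Matrix.one_mul, Matrix.mul_assoc, blockJ_mul_self, Matrix.mul_neg,
    Matrix.mul_one] at h2
  rw [Matrix.mul_assoc, ← neg_eq_iff_eq_neg, h2]

/-- Columns spanned by eigenvectors whose eigenvalues all have the same sign are isotropic. -/
lemma transpose_mul_blockJ_mul_eq_zero [Fintype l] [DecidableEq l] [Fintype ι] [DecidableEq ι]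
    {K : Matrix (l ⊕ l) (l ⊕ l) ℂ}
    (hK : Kᵀ * blockJ l * K = -blockJ l) {X : Matrix (l ⊕ l) ι ℂ} {d : ι → ℝ}
    (hX : K * X = X * diagonal fun i => (d i : ℂ)) (hd : ∀ i j, 0 < d i * d j) :
    Xᵀ * blockJ l * X = 0 := by
  have hXt : Xᵀ * Kᵀ = (diagonal fun i => (d i : ℂ)) * Xᵀ := by
    simpa using congrArg transpose hX
  have h : (diagonal fun i => (d i : ℂ)) * (Xᵀ * blockJ l * X) * (diagonal fun i => (d i : ℂ))
      = -(Xᵀ * blockJ l * X) := by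
    calc _ = ((diagonal fun i => (d i : ℂ)) * Xᵀ) * blockJ l
          * (X * diagonal fun i => (d i : ℂ)) := by simp only [Matrix.mul_assoc]
      _ = Xᵀ * (Kᵀ * blockJ l * K) * X := by rw [← hXt, ← hX]; simp only [Matrix.mul_assoc]
      _ = _ := by rw [hK]; simp
  ext i j
  have hij := congrFun (congrFun h i) j
  rw [Matrix.mul_diagonal, Matrix.diagonal_mul, Matrix.neg_apply] at hij
  have hne : (1 + d i * d j : ℂ) ≠ 0 := by
    have := hd i j
    exact_mod_cast (by positivity : (1 + d i * d j : ℝ) ≠ 0)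
  refine (mul_eq_zero.mp ?_).resolve_left hne
  linear_combination hij

lemma conjTranspose_mul_blockJ_mul_eq_zero [Fintype l] [DecidableEq l]
    {X : Matrix (l ⊕ l) ι ℂ}
    (h : Xᵀ * blockJ l * X = 0) : Xᴴ * blockJ l * Xᴴᵀ = 0 := by
  have hXt : Xᵀᴴᵀ = Xᴴ := by ext; simp
  have := congrArg (fun M => Mᴴᵀ) h
  simpa [hXt, blockJ_conjTranspose, blockJ_transpose, Matrix.mul_assoc] using this

lemma transpose_mul_conj [Fintype l] [DecidableEq ι]
    {X : Matrix (l ⊕ l) ι ℂ} (h : Xᴴ * X = 1) : Xᵀ * Xᴴᵀ = 1 := by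
  simpa using congrArg transpose h

/-- Orthonormal isotropic columns, completed by their images under the quaternionic structure,
are orthonormal. -/
lemma fromCols_conjTranspose_mul_self [Fintype l] [DecidableEq l] [DecidableEq ι]
    {X : Matrix (l ⊕ l) ι ℂ} (h1 : Xᴴ * X = 1)
    (h0 : Xᵀ * blockJ l * X = 0) :
    (fromCols X (-(blockJ l * Xᴴᵀ)))ᴴ * fromCols X (-(blockJ l * Xᴴᵀ)) = 1 := by
  have hc := conjTranspose_mul_blockJ_mul_eq_zero h0
  have hYc : (-(blockJ l * Xᴴᵀ))ᴴ = Xᵀ * blockJ l := by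
    have : Xᴴᵀᴴ = Xᵀ := by ext; simp
    simp [blockJ_conjTranspose, this]
  rw [conjTranspose_fromCols_eq_fromRows_conjTranspose, fromRows_mul_fromCols, hYc, h1, h0,
    Matrix.mul_neg, ← Matrix.mul_assoc, hc, Matrix.mul_neg, Matrix.mul_assoc Xᵀ,
    ← Matrix.mul_assoc (blockJ l), blockJ_mul_self]
  simp [transpose_mul_conj h1]

lemma card_le_card_of_orthonormal_isotropic [Fintype l] [DecidableEq l] [Fintype ι] [DecidableEq ι]
    {X : Matrix (l ⊕ l) ι ℂ} (h1 : Xᴴ * X = 1)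
    (h0 : Xᵀ * blockJ l * X = 0) : Fintype.card ι ≤ Fintype.card l := by
  have h := fromCols_conjTranspose_mul_self h1 h0
  have h2 := Matrix.rank_mul_le_left (fromCols X (-(blockJ l * Xᴴᵀ)))ᴴ
    (fromCols X (-(blockJ l * Xᴴᵀ)))
  rw [h, Matrix.rank_one] at h2
  have h3 := h2.trans (Matrix.rank_le_card_width _)
  simp only [Fintype.card_sum] at h3
  omega

lemma exists_symplectic_of_eigenvectors [Fintype l] [DecidableEq l]
    {K : Matrix (l ⊕ l) (l ⊕ l) ℂ}
    (hK : Kᵀ * blockJ l * K = -blockJ l) (hH : K.IsHermitian) {X : Matrix (l ⊕ l) l ℂ}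
    {d : l → ℝ} (h1 : Xᴴ * X = 1) (hX : K * X = X * diagonal fun i => (d i : ℂ))
    (hd : ∀ i, 0 < d i) :
    ∃ V : Matrix (l ⊕ l) (l ⊕ l) ℂ, Vᵀ * blockJ l * V = blockJ l ∧
      K = V * fromBlocks 1 0 0 (-1) * Vᴴ := by
  have h0 := transpose_mul_blockJ_mul_eq_zero hK hX fun i j => mul_pos (hd i) (hd j)
  have hc := conjTranspose_mul_blockJ_mul_eq_zero h0
  have ht := transpose_mul_conj h1
  have hU := mul_eq_one_comm.mp (fromCols_conjTranspose_mul_self h1 h0)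
  set Y := -(blockJ l * Xᴴᵀ) with hY
  set r : Matrix l l ℂ := diagonal fun i => (√(d i) : ℂ) with hr
  set q : Matrix l l ℂ := diagonal fun i => ((√(d i))⁻¹ : ℂ) with hq
  have hne : ∀ i, (√(d i) : ℂ) ≠ 0 := fun i => by
    exact_mod_cast (Real.sqrt_pos.mpr (hd i)).ne'
  have hsq : ∀ i, (√(d i) : ℂ) * √(d i) = d i := fun i => by
    exact_mod_cast Real.mul_self_sqrt (hd i).le
  have hrq : r * q = 1 := by simp [hr, hq, hne]
  have hqr : q * r = 1 := by simp [hr, hq, hne]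
  have hrr : r * r = diagonal fun i => (d i : ℂ) := by simp [hr, hsq]
  have hrt : rᵀ = r := by simp [hr]
  have hqt : qᵀ = q := by simp [hq]
  have hrc : rᴴ = r := by
    rw [hr, diagonal_conjTranspose]; congr 1; ext i; simp
  have hqc : qᴴ = q := by
    rw [hq, diagonal_conjTranspose]; congr 1; ext i; simp
  have hYt : Yᵀ = Xᴴ * blockJ l := by simp [hY, blockJ_transpose]
  have hXY : Xᵀ * blockJ l * Y = 1 := by
    rw [hY, Matrix.mul_neg, Matrix.mul_assoc, ← Matrix.mul_assoc (blockJ l), blockJ_mul_self]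
    simp [ht]
  have hYX : Yᵀ * blockJ l * X = -1 := by
    rw [hYt, Matrix.mul_assoc Xᴴ, blockJ_mul_self]
    simp [h1]
  have hYY : Yᵀ * blockJ l * Y = 0 := by
    rw [hYt, Matrix.mul_assoc Xᴴ, blockJ_mul_self, hY]
    simpa [Matrix.mul_assoc] using hc
  have hKY : K * Y = -(Y * (q * q)) := by
    have hXc : Kᵀ * Xᴴᵀ = Xᴴᵀ * (r * r) := by
      have := congrArg (fun M => Mᴴᵀ) hX
      rw [← hrr] at this
      simpa [hH.eq, hrc, hrt, Matrix.mul_assoc] using this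
    have e : K * Y * (r * r) = -Y := by
      rw [hY, Matrix.mul_neg, Matrix.neg_mul, Matrix.mul_assoc, Matrix.mul_assoc, ← hXc,
        ← Matrix.mul_assoc, ← Matrix.mul_assoc, mul_blockJ_mul_transpose hK, Matrix.neg_mul]
    have hrrqq : r * r * (q * q) = 1 := by
      rw [Matrix.mul_assoc, ← Matrix.mul_assoc r q, hrq, Matrix.one_mul, hrq]
    rw [← Matrix.neg_mul, ← e, Matrix.mul_assoc, hrrqq, Matrix.mul_one]
  refine ⟨fromCols (X * r) (Y * q), ?_, ?_⟩
  · rw [transpose_fromCols, fromRows_mul, fromRows_mul_fromCols, blockJ]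
    simp only [transpose_mul, hrt, hqt]
    rw [← blockJ]
    congr 1
    · calc _ = r * (Xᵀ * blockJ l * X) * r := by simp only [Matrix.mul_assoc]
        _ = 0 := by simp [h0]
    · calc _ = r * (Xᵀ * blockJ l * Y) * q := by simp only [Matrix.mul_assoc]
        _ = 1 := by simp [hXY, hrq]
    · calc _ = q * (Yᵀ * blockJ l * X) * r := by simp only [Matrix.mul_assoc]
        _ = -1 := by simp [hYX, hqr]
    · calc _ = q * (Yᵀ * blockJ l * Y) * q := by simp only [Matrix.mul_assoc]
        _ = 0 := by simp [hYY]
  · have hU' : X * Xᴴ + Y * Yᴴ = 1 := by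
      rwa [conjTranspose_fromCols_eq_fromRows_conjTranspose, fromCols_mul_fromRows] at hU
    rw [conjTranspose_fromCols_eq_fromRows_conjTranspose, fromCols_mul_fromBlocks,
      fromCols_mul_fromRows]
    simp only [conjTranspose_mul, hrc, hqc, Matrix.mul_one, Matrix.mul_zero, add_zero, zero_add,
      Matrix.mul_neg, Matrix.neg_mul]
    calc K = K * (X * Xᴴ + Y * Yᴴ) := by rw [hU', Matrix.mul_one]
      _ = K * X * Xᴴ + K * Y * Yᴴ := by simp only [Matrix.mul_add, Matrix.mul_assoc]
      _ = _ := by rw [hKY, hX, ← hrr]; simp only [Matrix.mul_assoc, Matrix.neg_mul]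

lemma conjTranspose_mul_self_submatrix_id {m : Type*} [Fintype m] [DecidableEq m]
    [DecidableEq ι] {U : Matrix m m ℂ} (hU : Uᴴ * U = 1) {s : ι → m}
    (hs : Function.Injective s) : (U.submatrix id s)ᴴ * U.submatrix id s = 1 := by
  ext i j
  have := congrFun (congrFun hU (s i)) (s j)
  simp only [Matrix.one_apply, hs.eq_iff] at this ⊢
  exact this

lemma mul_submatrix_id_eq_mul_diagonal {m : Type*} [Fintype m] [DecidableEq m] [Fintype ι]
    [DecidableEq ι] {K U : Matrix m m ℂ} {d : m → ℂ} (h : K * U = U * diagonal d) (s : ι → m) :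
    K * U.submatrix id s = U.submatrix id s * diagonal fun i => d (s i) := by
  ext i j
  have := congrFun (congrFun h i) (s j)
  rw [Matrix.mul_diagonal] at this ⊢
  exact this

/-- A Hermitian anti-symplectic matrix is congruent to the standard signature matrix by a
symplectic matrix. -/
lemma exists_symplectic_congruence [Fintype l] [DecidableEq l]
    {K : Matrix (l ⊕ l) (l ⊕ l) ℂ}
    (hH : K.IsHermitian) (hK : Kᵀ * blockJ l * K = -blockJ l) :
    ∃ V : Matrix (l ⊕ l) (l ⊕ l) ℂ, Vᵀ * blockJ l * V = blockJ l ∧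
      K = V * fromBlocks 1 0 0 (-1) * Vᴴ := by
  classical
  set U : Matrix (l ⊕ l) (l ⊕ l) ℂ := hH.eigenvectorUnitary.1 with hUdef
  set μ := hH.eigenvalues with hμ
  have hU : Uᴴ * U = 1 := Unitary.coe_star_mul_self hH.eigenvectorUnitary
  have hKU : K * U = U * diagonal fun i => (μ i : ℂ) := by
    ext i j
    rw [Matrix.mul_diagonal]
    have := congrFun (hH.mulVec_eigenvectorBasis j) i
    simpa [Matrix.mulVec, dotProduct, Matrix.mul_apply, hUdef, hμ, mul_comm] using this
  have hμ0 : ∀ i, μ i ≠ 0 := by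
    have hdet : K.det ≠ 0 := by
      intro h
      have hJ := congrArg Matrix.det (congrArg (· * blockJ l) hK)
      simp [Matrix.det_mul, h, blockJ_mul_self] at hJ
    rw [hH.det_eq_prod_eigenvalues, Finset.prod_ne_zero_iff] at hdet
    intro i h
    exact hdet i (Finset.mem_univ i) (by rw [← hμ, h]; simp)
  have hle : ∀ p : l ⊕ l → Prop, (∀ i j, p i → p j → 0 < μ i * μ j) →
      Fintype.card {i // p i} ≤ Fintype.card l := by
    intro p hp
    have h1 := conjTranspose_mul_self_submatrix_id hU
      (Subtype.val_injective : Function.Injective (Subtype.val : {i // p i} → l ⊕ l))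
    have hX := mul_submatrix_id_eq_mul_diagonal hKU (Subtype.val : {i // p i} → l ⊕ l)
    exact card_le_card_of_orthonormal_isotropic h1
      (transpose_mul_blockJ_mul_eq_zero hK hX fun i j => hp i j i.2 j.2)
  have hpos := hle (fun i => 0 < μ i) fun i j hi hj => mul_pos hi hj
  have hneg := hle (fun i => ¬ 0 < μ i) fun i j hi hj =>
    mul_pos_of_neg_of_neg (lt_of_le_of_ne (not_lt.mp hi) (hμ0 i))
      (lt_of_le_of_ne (not_lt.mp hj) (hμ0 j))
  have hcard : Fintype.card l = Fintype.card {i // 0 < μ i} := by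
    rw [Fintype.card_subtype_compl, Fintype.card_sum] at hneg
    omega
  have e := Fintype.equivOfCardEq hcard
  have h1 := conjTranspose_mul_self_submatrix_id hU (Subtype.val_injective.comp e.injective)
  have hX := mul_submatrix_id_eq_mul_diagonal hKU fun i => (e i).1
  exact exists_symplectic_of_eigenvectors hK hH h1 hX fun i => (e i).2

end SymplecticBlocks

/-- The splitting of `Fin (2 * n)` into its lower and upper halves. -/
def finTwoMulEquiv (n : ℕ) : Fin n ⊕ Fin n ≃ Fin (2 * n) :=
  finSumFinEquiv.trans (finCongr (two_mul n).symm)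

lemma Jmat_submatrix (n : ℕ) :
    (Jmat n).submatrix (finTwoMulEquiv n) (finTwoMulEquiv n) = blockJ (Fin n) := by
  ext i j
  rcases i with i | i <;> rcases j with j | j <;>
    simp [Jmat, blockJ, finTwoMulEquiv, Matrix.one_apply, Fin.ext_iff] <;> grind

lemma Smat_submatrix (n : ℕ) :
    (Smat (2 * n) n).submatrix (finTwoMulEquiv n) (finTwoMulEquiv n) =
      fromBlocks 1 0 0 (-1) := by
  ext i j
  rcases i with i | i <;> rcases j with j | j <;>
    simp [Smat, finTwoMulEquiv, Matrix.one_apply, Matrix.diagonal_apply, Fin.ext_iff] <;> grind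

/-- Every symplectic anti-Hermitian matrix `H` equals `i V S^{2n}_n V̄ᵗ` for some
symplectic `V`. -/
theorem stmt_10 (n : ℕ) (hn : 1 ≤ n) (H : Matrix (Fin (2 * n)) (Fin (2 * n)) ℂ)
    (hs : Hᵀ * Jmat n * H = Jmat n) (hH : H = -Hᴴ) :
    ∃ V : Matrix (Fin (2 * n)) (Fin (2 * n)) ℂ,
      Vᵀ * Jmat n * V = Jmat n ∧ H = Complex.I • (V * Smat (2 * n) n * Vᴴ) := by
  set e := finTwoMulEquiv n
  have hJ : Jmat n = (blockJ (Fin n)).submatrix e.symm e.symm := by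
    rw [← Jmat_submatrix]; simp [e]
  have hS : Smat (2 * n) n = (fromBlocks 1 0 0 (-1)).submatrix e.symm e.symm := by
    rw [← Smat_submatrix]; simp [e]
  set K := (-Complex.I) • H.submatrix e e with hKdef
  have hKH : K.IsHermitian := by
    rw [Matrix.IsHermitian, hKdef, conjTranspose_smul, conjTranspose_submatrix]
    nth_rewrite 2 [hH]
    ext i j
    simp
  have hKs : Kᵀ * blockJ (Fin n) * K = -blockJ (Fin n) := by
    have h := congrArg (fun M => M.submatrix e e) hs
    simp only [← submatrix_mul_equiv _ _ _ e _, e, Jmat_submatrix] at h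
    rw [hKdef, transpose_smul, transpose_submatrix]
    simp only [Matrix.smul_mul, Matrix.mul_smul, smul_smul, e, h]
    simp
  obtain ⟨V, hV, hKV⟩ := exists_symplectic_congruence hKH hKs
  refine ⟨V.submatrix e.symm e.symm, ?_, ?_⟩
  · rw [hJ, transpose_submatrix, submatrix_mul_equiv, submatrix_mul_equiv, hV]
  · rw [hS, conjTranspose_submatrix, submatrix_mul_equiv, submatrix_mul_equiv, ← hKV, hKdef]
    ext i j
    simp [← mul_assoc]
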